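/- arXiv:math/0610079 — 3 statements merged into one kernel-verified Lean document; each statement's English description precedes it below -/
import Mathlib

section
/- Let 0 < β ≤ 1 and let μ be a positive Borel measure on the upper half-space R^{n+1}_+. Then there is a constant C₁ < ∞ such that μ(TB) ≤ C₁ |B|^β for all balls B ⊆ R^n (where |B| is Lebesgue measure) if and only if there is a constant C₂ < ∞ such that μ(TO) ≤ C₂ Λ^∞_{nβ}(O) for every open set O ⊆ R^n. -/
open MeasureTheory Metric Set ENNReal Filter

noncomputable section

/-- The tent over a set `E`: points `(x,t)` with `x ∈ E`, `0 < t`, and `t < dist(x, ∂E)`. -/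
def tent {X : Type*} [MetricSpace X] (E : Set X) : Set (X × ℝ) :=
  {p | p.1 ∈ E ∧ 0 < p.2 ∧ p.2 < Metric.infDist p.1 (frontier E)}

/-- Euclidean space `ℝ^n`. -/
abbrev En (n : ℕ) := EuclideanSpace ℝ (Fin n)

/-- Hausdorff capacity `Λ^∞_w` with gauge function `w`. -/
def hausdorffCapW {n : ℕ} (w : ℝ → ℝ) (E : Set (En n)) : ℝ≥0∞ :=
  ⨅ (z : ℕ → En n) (r : ℕ → ℝ) (_ : ∀ j, 0 < r j) (_ : E ⊆ ⋃ j, ball (z j) (r j)),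
    ∑' j, ENNReal.ofReal (w (r j))

/-- The `d`-dimensional Hausdorff capacity `Λ^∞_d`. -/
def hausdorffCap {n : ℕ} (d : ℝ) (E : Set (En n)) : ℝ≥0∞ :=
  hausdorffCapW (fun r => r ^ d) E

/-- A point of the tent over a set carries a ball contained in that set. -/
theorem ball_subset_of_mem_tent {E : Type*} [NormedAddCommGroup E] [NormedSpace ℝ E]
    {O : Set E} (hO : IsOpen O) {p : E × ℝ} (hp : p ∈ tent O) : ball p.1 p.2 ⊆ O := by
  obtain ⟨hx, ht, hd⟩ := hp
  have hpre : IsPreconnected (ball p.1 p.2) := (convex_ball p.1 p.2).isPreconnected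
  refine hpre.subset_of_closure_inter_subset hO ⟨p.1, mem_ball_self ht, hx⟩ ?_
  rintro y ⟨hy, hyb⟩
  by_contra hyO
  have hyf : y ∈ frontier O := by
    rw [frontier, hO.interior_eq]
    exact ⟨hy, hyO⟩
  have := infDist_le_dist_of_mem (x := p.1) hyf
  rw [mem_ball, dist_comm] at hyb
  linarith

/-- A ball of radius larger than `t` around `x` inside a ball `D` puts `(x, t)` in the tent
over `D`. -/
theorem mem_tent_ball {E : Type*} [NormedAddCommGroup E] [NormedSpace ℝ E] [Nontrivial E]
    {c x : E} {R s t : ℝ} (ht : 0 < t) (hts : t < s) (h : ball x s ⊆ ball c R) :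
    (x, t) ∈ tent (ball c R) := by
  have hx : x ∈ ball c R := h (mem_ball_self (ht.trans hts))
  refine ⟨hx, ht, hts.trans_le ?_⟩
  have hne : (frontier (ball c R)).Nonempty := by
    refine nonempty_frontier_iff.2 ⟨⟨x, hx⟩, fun hu => ?_⟩
    exact NormedSpace.unbounded_univ ℝ E (hu ▸ isBounded_ball)
  refine (le_infDist hne).2 fun y hy => ?_
  rw [frontier, isOpen_ball.interior_eq] at hy
  by_contra! hlt
  exact hy.2 (h (by rwa [mem_ball, dist_comm]))

/-- If countably many balls of radii at most `t` cover a ball of radius `t`, then their radii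
satisfy `t ^ d ≤ ∑ r_j ^ d` for every `d ≤ n`. -/
theorem rpow_le_tsum_of_ball_subset {n : ℕ} {d : ℝ} (hdn : d ≤ n) {ι : Type*} [Countable ι]
    {z : ι → En n} {r : ι → ℝ} (hr : ∀ j, 0 < r j) {x : En n} {t : ℝ} (ht : 0 < t)
    (hrt : ∀ j, r j ≤ t) (h : ball x t ⊆ ⋃ j, ball (z j) (r j)) :
    ENNReal.ofReal (t ^ d) ≤ ∑' j, ENNReal.ofReal (r j ^ d) := by
  set v : ℝ≥0∞ := volume (ball (0 : En n) 1)
  have hv0 : v ≠ 0 := (measure_ball_pos _ _ one_pos).ne'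
  have hvtop : v ≠ ∞ := measure_ball_lt_top.ne
  have hvol : ∀ (c : En n) {s : ℝ}, 0 < s → volume (ball c s) = ENNReal.ofReal (s ^ n) * v := by
    intro c s hs
    rw [Measure.addHaar_ball_of_pos _ _ hs, finrank_euclideanSpace_fin]
  have hsum : ENNReal.ofReal (t ^ n) ≤ ∑' j, ENNReal.ofReal (r j ^ n) := by
    have hle := (measure_mono h).trans (measure_iUnion_le (μ := volume) _)
    simp_rw [hvol x ht, hvol _ (hr _)] at hle
    rw [ENNReal.tsum_mul_right] at hle
    exact (ENNReal.mul_le_mul_iff_left hv0 hvtop).1 hle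
  have hsplit : ∀ {s : ℝ}, 0 < s → s ^ n = s ^ ((n : ℝ) - d) * s ^ d := by
    intro s hs
    rw [← Real.rpow_add hs, sub_add_cancel, Real.rpow_natCast]
  have hpos : 0 < t ^ ((n : ℝ) - d) := Real.rpow_pos_of_pos ht _
  refine (ENNReal.mul_le_mul_iff_right (ENNReal.ofReal_pos.2 hpos).ne' ENNReal.ofReal_ne_top).1 ?_
  rw [← ENNReal.ofReal_mul hpos.le, ← hsplit ht, ← ENNReal.tsum_mul_left]
  refine hsum.trans (ENNReal.tsum_le_tsum fun j => ?_)
  rw [← ENNReal.ofReal_mul hpos.le, hsplit (hr j)]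
  refine ENNReal.ofReal_le_ofReal (mul_le_mul_of_nonneg_right ?_ (Real.rpow_nonneg (hr j).le _))
  exact Real.rpow_le_rpow (hr j).le (hrt j) (sub_nonneg.2 hdn)

/-- A Carleson type condition on balls controls the measure of the tent over an open set by the
`d`-th power sum of the radii of any countable cover by balls. -/
theorem measure_tent_le_of_cover {n : ℕ} (hn : 0 < n) {d : ℝ} (hd : 0 < d) (hdn : d ≤ n)
    {μ : Measure (En n × ℝ)} {K : ℝ} (hK : 0 < K)
    (hμ : ∀ (z : En n) (r : ℝ), 0 < r → μ (tent (ball z r)) ≤ ENNReal.ofReal (K * r ^ d))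
    {O : Set (En n)} (hO : IsOpen O) {z : ℕ → En n} {r : ℕ → ℝ} (hr : ∀ j, 0 < r j)
    (hcov : O ⊆ ⋃ j, ball (z j) (r j)) :
    μ (tent O) ≤ ENNReal.ofReal (K * 3 ^ d + K * 16 ^ d) * ∑' j, ENNReal.ofReal (r j ^ d) := by
  have : Nonempty (Fin n) := ⟨⟨0, hn⟩⟩
  have hscale : ∀ (a : ℝ), 0 < a → ∀ (c : En n) (s : ℝ), 0 < s →
      μ (tent (ball c (a * s))) ≤ ENNReal.ofReal (K * a ^ d) * ENNReal.ofReal (s ^ d) := by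
    intro a ha c s hs
    refine (hμ c _ (mul_pos ha hs)).trans_eq ?_
    rw [← ENNReal.ofReal_mul (by positivity), Real.mul_rpow ha.le hs.le, mul_assoc]
  set S : ℝ≥0∞ := ∑' j, ENNReal.ofReal (r j ^ d)
  by_cases hStop : S = ∞
  · have h0 : 0 < K * 3 ^ d + K * 16 ^ d := by positivity
    rw [hStop, ENNReal.mul_top (ENNReal.ofReal_pos.2 h0).ne']
    exact le_top
  let bad : Set (En n × ℝ) :=
    {p | p ∈ tent O ∧ ∀ j, (ball (z j) (r j) ∩ ball p.1 p.2).Nonempty → r j ≤ p.2}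
  let J : En n × ℝ → Set ℕ := fun p => {j | ball (z j) (r j) ⊆ closedBall p.1 (3 * p.2)}
  have hbadpos : ∀ p ∈ bad, 0 < p.2 := fun p hp => hp.1.2.1
  have hJ : ∀ p ∈ bad, ENNReal.ofReal (p.2 ^ d) ≤ ∑' j : J p, ENNReal.ofReal (r j ^ d) := by
    intro p hp
    let I : Set ℕ := {j | (ball (z j) (r j) ∩ ball p.1 p.2).Nonempty}
    have hIJ : I ⊆ J p := by
      intro j hj y hy
      have hle := hp.2 j hj
      obtain ⟨w, hw1, hw2⟩ := hj
      rw [mem_ball] at hw1 hw2 hy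
      rw [mem_closedBall]
      have h1 := dist_triangle y (z j) p.1
      have h2 := dist_triangle_left (z j) p.1 w
      linarith
    refine (rpow_le_tsum_of_ball_subset hdn (ι := I) (z := fun j => z j) (r := fun j => r j)
      (x := p.1)
      (fun j => hr j) (hbadpos p hp) (fun j => hp.2 j j.2) ?_).trans
      (ENNReal.tsum_mono_subtype (fun j => ENNReal.ofReal (r j ^ d)) hIJ)
    intro y hy
    obtain ⟨j, hj⟩ := mem_iUnion.1 (hcov (ball_subset_of_mem_tent hO hp.1 hy))
    exact mem_iUnion.2 ⟨⟨j, ⟨y, hj, hy⟩⟩, hj⟩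
  have hbound : ∀ p ∈ bad, 3 * p.2 ≤ 3 * S.toReal ^ d⁻¹ := by
    intro p hp
    have h1 : ENNReal.ofReal (p.2 ^ d) ≤ S :=
      (hJ p hp).trans (ENNReal.tsum_comp_le_tsum_of_injective Subtype.val_injective _)
    have h2 : p.2 ^ d ≤ S.toReal := (ENNReal.ofReal_le_iff_le_toReal hStop).1 h1
    have h3 := (Real.le_rpow_inv_iff_of_pos (hbadpos p hp).le ENNReal.toReal_nonneg hd).2 h2
    linarith
  obtain ⟨u, hub, hdisj, hucov⟩ := Vitali.exists_disjoint_subfamily_covering_enlargement_closedBall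
    bad (fun p => p.1) (fun p => 3 * p.2) _ hbound 5 (by norm_num)
  have hucount : u.Countable := hdisj.countable_of_nonempty_interior fun p hp =>
    ⟨p.1, ball_subset_interior_closedBall
      (mem_ball_self (mul_pos three_pos (hbadpos p (hub hp))))⟩
  have := hucount.to_subtype
  have hJdisj : u.PairwiseDisjoint J := by
    intro p hp q hq hpq
    refine Set.disjoint_left.2 fun j hjp hjq => ?_
    have hmem := mem_ball_self (x := z j) (hr j)
    exact Set.disjoint_left.1 (hdisj hp hq hpq) (hjp hmem) (hjq hmem)
  have husum : ∑' p : u, ENNReal.ofReal (p.1.2 ^ d) ≤ S :=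
    calc ∑' p : u, ENNReal.ofReal (p.1.2 ^ d)
        ≤ ∑' p : u, ∑' j : J p, ENNReal.ofReal (r j ^ d) :=
          ENNReal.tsum_le_tsum fun p => hJ p (hub p.2)
      _ = ∑' j : ⋃ p ∈ u, J p, ENNReal.ofReal (r j ^ d) :=
          (ENNReal.tsum_biUnion' (f := fun j => ENNReal.ofReal (r j ^ d)) hJdisj).symm
      _ ≤ S := ENNReal.tsum_comp_le_tsum_of_injective Subtype.val_injective _
  have hsub : tent O ⊆ (⋃ j, tent (ball (z j) (3 * r j))) ∪
      ⋃ p : u, tent (ball p.1.1 (16 * p.1.2)) := by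
    rintro ⟨x, t⟩ hp
    have ht : 0 < t := hp.2.1
    by_cases hb : (x, t) ∈ bad
    · right
      obtain ⟨q, hq, hsubq⟩ := hucov _ hb
      refine mem_iUnion.2 ⟨⟨q, hq⟩, mem_tent_ball ht (s := 3 * t) (by linarith) ?_⟩
      refine ball_subset_closedBall.trans (hsubq.trans (closedBall_subset_ball ?_))
      have := hbadpos q (hub hq)
      linarith
    · left
      have : ∃ j, (ball (z j) (r j) ∩ ball x t).Nonempty ∧ t < r j := by
        by_contra! hcon
        exact hb ⟨hp, hcon⟩
      obtain ⟨j, ⟨w, hw1, hw2⟩, hlt⟩ := this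
      refine mem_iUnion.2 ⟨j, mem_tent_ball ht hlt (ball_subset_ball' ?_)⟩
      rw [mem_ball] at hw1 hw2
      have := dist_triangle_left x (z j) w
      linarith
  calc μ (tent O)
      ≤ ∑' j, μ (tent (ball (z j) (3 * r j))) + ∑' p : u, μ (tent (ball p.1.1 (16 * p.1.2))) :=
        (measure_mono hsub).trans ((measure_union_le _ _).trans
          (add_le_add (measure_iUnion_le _) (measure_iUnion_le _)))
    _ ≤ ∑' j, ENNReal.ofReal (K * 3 ^ d) * ENNReal.ofReal (r j ^ d) +
        ∑' p : u, ENNReal.ofReal (K * 16 ^ d) * ENNReal.ofReal (p.1.2 ^ d) :=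
        add_le_add (ENNReal.tsum_le_tsum fun j => hscale 3 (by norm_num) _ _ (hr j))
          (ENNReal.tsum_le_tsum fun p => hscale 16 (by norm_num) _ _ (hbadpos p (hub p.2)))
    _ ≤ ENNReal.ofReal (K * 3 ^ d) * S + ENNReal.ofReal (K * 16 ^ d) * S := by
        rw [ENNReal.tsum_mul_left, ENNReal.tsum_mul_left]
        gcongr
    _ = ENNReal.ofReal (K * 3 ^ d + K * 16 ^ d) * S := by
        rw [ENNReal.ofReal_add (by positivity) (by positivity), add_mul]

/-- The `d`-dimensional capacity of a ball is at most the `d`-th power of its radius. -/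
theorem hausdorffCap_ball_le {n : ℕ} {d : ℝ} (hd : 0 < d) (c : En n) {s : ℝ} (hs : 0 < s) :
    hausdorffCap d (ball c s) ≤ ENNReal.ofReal (s ^ d) := by
  refine ENNReal.le_of_forall_pos_le_add fun ε hε _ => ?_
  obtain ⟨δ, hδ, hδsum⟩ := ENNReal.exists_pos_sum_of_countable (ENNReal.coe_pos.2 hε).ne' ℕ
  let r : ℕ → ℝ := fun j => if j = 0 then s else (δ j : ℝ) ^ d⁻¹
  have hr : ∀ j, 0 < r j := by
    intro j
    by_cases hj : j = 0
    · simpa [r, hj] using hs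
    · simpa [r, hj] using Real.rpow_pos_of_pos (NNReal.coe_pos.2 (hδ j)) d⁻¹
  have hcov : ball c s ⊆ ⋃ j, ball c (r j) := by
    intro y hy
    exact mem_iUnion.2 ⟨0, by simpa [r] using hy⟩
  refine (iInf₂_le_of_le (fun _ => c) r (iInf₂_le hr hcov)).trans ?_
  calc ∑' j, ENNReal.ofReal (r j ^ d)
      ≤ ∑' j, ((if j = 0 then ENNReal.ofReal (s ^ d) else 0) + (δ j : ℝ≥0∞)) := by
        refine ENNReal.tsum_le_tsum fun j => ?_
        by_cases hj : j = 0
        · simp [r, hj]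
        · simp [r, hj, Real.rpow_inv_rpow (NNReal.coe_nonneg _) hd.ne']
    _ ≤ ENNReal.ofReal (s ^ d) + ε := by
        rw [ENNReal.tsum_add, tsum_ite_eq]
        exact add_le_add le_rfl hδsum.le

/-- The power `β` of the volume of a ball is a multiple of the power `n β` of its radius. -/
theorem toReal_volume_ball_rpow {n : ℕ} (β : ℝ) (c : En n) {s : ℝ} (hs : 0 < s) :
    (volume (ball c s)).toReal ^ β =
      (volume (ball (0 : En n) 1)).toReal ^ β * s ^ ((n : ℝ) * β) := by
  rw [Measure.addHaar_ball_of_pos _ _ hs, finrank_euclideanSpace_fin, ENNReal.toReal_mul,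
    ENNReal.toReal_ofReal (by positivity), Real.mul_rpow (by positivity) ENNReal.toReal_nonneg,
    Real.rpow_mul hs.le, Real.rpow_natCast, mul_comm]

/-- For `0 < β ≤ 1`, a positive Borel measure `μ` on `ℝ^{n+1}_+` satisfies
`μ(TB) ≤ C₁ |B|^β` for all balls `B ⊆ ℝ^n` iff it satisfies
`μ(TO) ≤ C₂ Λ^∞_{nβ}(O)` for all open sets `O ⊆ ℝ^n`. -/
theorem stmt0 (n : ℕ) (hn : 0 < n) (β : ℝ) (hβ0 : 0 < β) (hβ1 : β ≤ 1)
    (μ : Measure (En n × ℝ)) :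
    (∃ C₁ : ℝ, 0 < C₁ ∧ ∀ (z : En n) (r : ℝ), 0 < r →
        μ (tent (ball z r)) ≤ ENNReal.ofReal (C₁ * (volume (ball z r)).toReal ^ β)) ↔
    (∃ C₂ : ℝ, 0 < C₂ ∧ ∀ O : Set (En n), IsOpen O →
        μ (tent O) ≤ ENNReal.ofReal C₂ * hausdorffCap ((n : ℝ) * β) O) := by
  have hn' : (0 : ℝ) < n := Nat.cast_pos.2 hn
  have hd : 0 < (n : ℝ) * β := mul_pos hn' hβ0
  have hv : 0 < (volume (ball (0 : En n) 1)).toReal ^ β :=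
    Real.rpow_pos_of_pos (ENNReal.toReal_pos (measure_ball_pos _ _ one_pos).ne'
      measure_ball_lt_top.ne) _
  constructor
  · rintro ⟨C, hC, h⟩
    have hK : 0 < C * (volume (ball (0 : En n) 1)).toReal ^ β := mul_pos hC hv
    refine ⟨_, (by positivity : 0 < C * (volume (ball (0 : En n) 1)).toReal ^ β *
        3 ^ ((n : ℝ) * β) + C * (volume (ball (0 : En n) 1)).toReal ^ β * 16 ^ ((n : ℝ) * β)),
      fun O hO => ?_⟩
    simp only [hausdorffCap, hausdorffCapW, ENNReal.mul_iInf_of_ne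
      (ENNReal.ofReal_pos.2 (by positivity : 0 < C * (volume (ball (0 : En n) 1)).toReal ^ β *
        3 ^ ((n : ℝ) * β) + C * (volume (ball (0 : En n) 1)).toReal ^ β *
        16 ^ ((n : ℝ) * β))).ne' ENNReal.ofReal_ne_top]
    refine le_iInf₂ fun z r => le_iInf₂ fun hr hcov =>
      measure_tent_le_of_cover hn hd (by nlinarith) hK (fun c s hs => ?_) hO hr hcov
    rw [mul_assoc, ← toReal_volume_ball_rpow β c hs]
    exact h c s hs
  · rintro ⟨C, hC, h⟩
    refine ⟨C / (volume (ball (0 : En n) 1)).toReal ^ β, div_pos hC hv, fun c s hs => ?_⟩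
    rw [toReal_volume_ball_rpow β c hs, ← mul_assoc, div_mul_cancel₀ _ hv.ne',
      ENNReal.ofReal_mul hC.le]
    exact (h _ isOpen_ball).trans (by gcongr; exact hausdorffCap_ball_le hd c hs)

end
end

section
/- For every 0 < β < 1 there exists a positive Borel measure μ on the upper half-plane R²_+ = R × (0,∞) (namely μ = Σ_{k≥1} (1/k) δ_{(k, k^{-1/β})}, a sum of weighted Dirac masses) and a constant C₀ < ∞ such that μ(TI) ≤ C₀ |I|^β for every bounded open interval I ⊆ R, while there exists a sequence of bounded open sets O_K ⊆ R with sup_K |O_K| < ∞ and μ(T O_K) → ∞ as K → ∞; in particular there is no constant C with μ(TO) ≤ C |O|^β for all bounded open sets O ⊆ R. -/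
open MeasureTheory Metric Set ENNReal Filter

noncomputable section

/-- The measure `μ = Σ_{k≥1} (1/k) δ_{(k, k^{-1/β})}` on the upper half-plane. -/
def paperMeasure (β : ℝ) : Measure (ℝ × ℝ) :=
  Measure.sum (fun k : ℕ =>
    ((k : ℝ≥0∞) + 1)⁻¹ •
      Measure.dirac (((k : ℝ) + 1), ((k : ℝ) + 1) ^ (-(1/β))))

open scoped Classical in
theorem paperMeasure_apply (β : ℝ) (s : Set (ℝ × ℝ)) :
    paperMeasure β s = ∑' k : ℕ,
      if (((k : ℝ) + 1), ((k : ℝ) + 1) ^ (-(1 / β))) ∈ s then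
        ENNReal.ofReal (1 / ((k : ℝ) + 1)) else 0 := by
  rw [paperMeasure, Measure.sum_apply_of_countable]
  refine tsum_congr fun k => ?_
  have hk : ENNReal.ofReal (1 / ((k : ℝ) + 1)) = ((k : ℝ≥0∞) + 1)⁻¹ := by
    rw [one_div, ENNReal.ofReal_inv_of_pos (by positivity),
      ENNReal.ofReal_add (by positivity) zero_le_one]
    simp
  rw [Measure.smul_apply, Measure.dirac_apply, hk, Set.indicator_apply]
  split_ifs <;> simp

/-- If every atom of `paperMeasure β` lying in `s` is indexed by `S`, then `s` has mass at most
the total weight of `S`. -/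
theorem paperMeasure_le_sum {β : ℝ} {s : Set (ℝ × ℝ)} {S : Finset ℕ}
    (h : ∀ k : ℕ, (((k : ℝ) + 1), ((k : ℝ) + 1) ^ (-(1 / β))) ∈ s → k ∈ S) :
    paperMeasure β s ≤ ENNReal.ofReal (∑ k ∈ S, 1 / ((k : ℝ) + 1)) := by
  classical
  rw [paperMeasure_apply, tsum_eq_sum (s := S) fun k hk => if_neg fun hs => hk (h k hs),
    ENNReal.ofReal_sum_of_nonneg fun k _ => by positivity]
  refine Finset.sum_le_sum fun k _ => ?_
  split_ifs <;> simp

/-- If all atoms of `paperMeasure β` indexed by `S` lie in `s`, then `s` has mass at least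
the total weight of `S`. -/
theorem sum_le_paperMeasure {β : ℝ} {s : Set (ℝ × ℝ)} {S : Finset ℕ}
    (h : ∀ k ∈ S, (((k : ℝ) + 1), ((k : ℝ) + 1) ^ (-(1 / β))) ∈ s) :
    ENNReal.ofReal (∑ k ∈ S, 1 / ((k : ℝ) + 1)) ≤ paperMeasure β s := by
  classical
  rw [paperMeasure_apply, ENNReal.ofReal_sum_of_nonneg fun k _ => by positivity]
  refine le_trans (Finset.sum_le_sum fun k hk => ?_) (ENNReal.sum_le_tsum S)
  rw [if_pos (h k hk)]

theorem mem_tent_of_ball_subset {O : Set ℝ} (hO : IsOpen O) (hb : Bornology.IsBounded O)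
    {x t r : ℝ} (ht : 0 < t) (htr : t < r) (hsub : ball x r ⊆ O) : (x, t) ∈ tent O := by
  have hx : x ∈ O := hsub (mem_ball_self (ht.trans htr))
  have hne : O ≠ univ := by
    rintro rfl
    exact NormedSpace.unbounded_univ ℝ ℝ hb
  have hf : (frontier O).Nonempty := nonempty_frontier_iff.2 ⟨⟨x, hx⟩, hne⟩
  refine ⟨hx, ht, htr.trans_le ((le_infDist hf).2 fun y hy => ?_)⟩
  by_contra! hlt
  rw [hO.frontier_eq] at hy
  exact hy.2 (hsub (by rwa [mem_ball, dist_comm]))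

theorem lt_sub_of_mem_tent_Ioo {a b x t : ℝ} (h : (x, t) ∈ tent (Ioo a b)) : t < b - a := by
  obtain ⟨hx, -, ht⟩ := h
  have hab : a < b := hx.1.trans hx.2
  have hmem : a ∈ frontier (Ioo a b) := by simp [frontier_Ioo hab]
  have := infDist_le_dist_of_mem (x := x) hmem
  rw [Real.dist_eq, abs_of_pos (sub_pos.2 hx.1)] at this
  have := hx.2
  simp only at ht
  linarith

theorem exists_finset_nat_mem_Ioo {a b : ℝ} (hab : a < b) :
    ∃ S : Finset ℕ, (∀ k : ℕ, k ∈ S ↔ (k : ℝ) + 1 ∈ Ioo a b) ∧ (S.card : ℝ) < b - a + 1 := by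
  have hfin : {k : ℕ | (k : ℝ) + 1 ∈ Ioo a b}.Finite := by
    refine (Set.finite_Iic ⌊b⌋₊).subset fun k hk => Nat.le_floor ?_
    have := hk.2
    linarith
  refine ⟨hfin.toFinset, by simp, ?_⟩
  have hcard : hfin.toFinset.card ≤ (Finset.Ioo ⌊a⌋ ⌈b⌉).card := by
    refine Finset.card_le_card_of_injOn (fun k : ℕ => (k : ℤ) + 1) (fun k hk => ?_)
      fun k _ l _ hkl => by simpa using hkl
    obtain ⟨h₁, h₂⟩ : (k : ℝ) + 1 ∈ Ioo a b := by simpa using hk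
    simp only [Finset.coe_Ioo, Set.mem_Ioo, Int.floor_lt, Int.lt_ceil]
    push_cast
    exact ⟨h₁, h₂⟩
  rw [Int.card_Ioo] at hcard
  have hle : ⌊a⌋ + 1 ≤ ⌈b⌉ := by
    have : (⌊a⌋ : ℝ) < ⌈b⌉ := (Int.floor_le a).trans_lt (hab.trans_le (Int.le_ceil b))
    exact_mod_cast this
  have hz : (hfin.toFinset.card : ℤ) ≤ ⌈b⌉ - ⌊a⌋ - 1 := by omega
  have hr : (hfin.toFinset.card : ℝ) ≤ ⌈b⌉ - ⌊a⌋ - 1 := by exact_mod_cast hz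
  linarith [Int.ceil_lt_add_one b, Int.lt_floor_add_one a]

theorem summable_nat_add_one_rpow_neg {p : ℝ} (hp : 1 < p) :
    Summable fun k : ℕ => ((k : ℝ) + 1) ^ (-p) := by
  have h := (summable_nat_add_iff 1).2 (Real.summable_nat_rpow.2 (show -p < -1 by linarith))
  simpa using h

theorem inv_lt_rpow_of_rpow_neg_lt {β x L : ℝ} (hβ : 0 < β) (hx : 0 < x)
    (h : x ^ (-(1 / β)) < L) : 1 / x < L ^ β := by
  have := Real.rpow_lt_rpow (by positivity) h hβ
  rwa [← Real.rpow_mul hx.le, show -(1 / β) * β = -1 by field_simp, Real.rpow_neg_one,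
    ← one_div] at this

/-- A Young inequality that splits `1 / x` into a constant part and a summable part. -/
theorem one_div_le_rpow_mul_add {β x L : ℝ} (hβ0 : 0 < β) (hβ1 : β < 1) (hx : 0 < x)
    (hL : 0 < L) : 1 / x ≤ L ^ β * (1 / L + x ^ (-(1 / (1 - β)))) := by
  have h1 : 0 < 1 - β := sub_pos.2 hβ1
  have hxp : 0 < x ^ (-(1 / (1 - β))) := by positivity
  have hy := Real.geom_mean_le_arith_mean2_weighted hβ0.le h1.le (one_div_pos.2 hL).le hxp.le
    (by ring)
  rw [← Real.rpow_mul hx.le, show -(1 / (1 - β)) * (1 - β) = -1 by field_simp,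
    Real.rpow_neg_one, one_div, Real.inv_rpow hL.le, ← one_div L] at hy
  have hLp : 0 < L ^ β := by positivity
  calc 1 / x = L ^ β * ((L ^ β)⁻¹ * x⁻¹) := by field_simp
    _ ≤ L ^ β * (β * (1 / L) + (1 - β) * x ^ (-(1 / (1 - β)))) := by gcongr
    _ ≤ _ := by
      gcongr
      · exact mul_le_of_le_one_left (by positivity) hβ1.le
      · exact mul_le_of_le_one_left hxp.le (by linarith)

theorem exists_paperMeasure_tent_Ioo_le {β : ℝ} (hβ0 : 0 < β) (hβ1 : β < 1) :
    ∃ C₀ : ℝ, 0 < C₀ ∧ ∀ a b : ℝ, a < b →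
      paperMeasure β (tent (Set.Ioo a b)) ≤ ENNReal.ofReal (C₀ * (b - a) ^ β) := by
  have hsum : Summable fun k : ℕ => ((k : ℝ) + 1) ^ (-(1 / (1 - β))) :=
    summable_nat_add_one_rpow_neg (by rw [lt_div_iff₀] <;> linarith)
  set A := ∑' k : ℕ, ((k : ℝ) + 1) ^ (-(1 / (1 - β)))
  have hA : 0 ≤ A := tsum_nonneg fun k => by positivity
  refine ⟨2 + A, by positivity, fun a b hab => ?_⟩
  obtain ⟨S, hS, hcard⟩ := exists_finset_nat_mem_Ioo hab
  set L := b - a with hLdef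
  have hL : 0 < L := sub_pos.2 hab
  have hLp : 0 < L ^ β := by positivity
  rcases lt_or_ge L 1 with hL1 | hL1
  · have hS1 : (S.card : ℝ) ≤ 1 := by
      have : (S.card : ℝ) < (2 : ℕ) := by push_cast; linarith
      have : S.card < 2 := by exact_mod_cast this
      exact_mod_cast Nat.le_of_lt_succ this
    refine (paperMeasure_le_sum (S := S.filter fun k => 1 / ((k : ℝ) + 1) ≤ L ^ β)
      fun k hk => ?_).trans (ENNReal.ofReal_le_ofReal ?_)
    · exact Finset.mem_filter.2 ⟨(hS k).2 hk.1,
        (inv_lt_rpow_of_rpow_neg_lt hβ0 (by positivity) (lt_sub_of_mem_tent_Ioo hk)).le⟩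
    · have hF : ((S.filter fun k : ℕ => 1 / ((k : ℝ) + 1) ≤ L ^ β).card : ℝ) ≤ 1 :=
        le_trans (by exact_mod_cast Finset.card_filter_le _ _) hS1
      have h := Finset.sum_le_card_nsmul (S.filter fun k : ℕ => 1 / ((k : ℝ) + 1) ≤ L ^ β)
        (fun k : ℕ => 1 / ((k : ℝ) + 1)) (L ^ β) fun k hk => (Finset.mem_filter.1 hk).2
      rw [nsmul_eq_mul] at h
      refine h.trans ?_
      gcongr
      linarith
  · refine (paperMeasure_le_sum (S := S) fun k hk => (hS k).2 hk.1).trans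
      (ENNReal.ofReal_le_ofReal ?_)
    calc ∑ k ∈ S, 1 / ((k : ℝ) + 1)
        ≤ ∑ k ∈ S, L ^ β * (1 / L + ((k : ℝ) + 1) ^ (-(1 / (1 - β)))) :=
          Finset.sum_le_sum fun k _ => one_div_le_rpow_mul_add hβ0 hβ1 (by positivity) hL
      _ = (S.card * (1 / L) + ∑ k ∈ S, ((k : ℝ) + 1) ^ (-(1 / (1 - β)))) * L ^ β := by
          rw [← Finset.mul_sum, Finset.sum_add_distrib, Finset.sum_const, nsmul_eq_mul, mul_comm]
      _ ≤ (2 + A) * L ^ β := by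
          gcongr
          · rw [mul_one_div, div_le_iff₀ hL]
            linarith
          · exact hsum.sum_le_tsum _ fun k _ => by positivity

theorem exists_isOpen_tendsto_paperMeasure_tent {β : ℝ} (hβ0 : 0 < β) (hβ1 : β < 1) :
    ∃ O : ℕ → Set ℝ, (∀ K, IsOpen (O K)) ∧ (∀ K, Bornology.IsBounded (O K)) ∧
      (∃ M : ℝ, ∀ K, volume (O K) ≤ ENNReal.ofReal M) ∧
      Tendsto (fun K => paperMeasure β (tent (O K))) atTop (nhds ⊤) := by
  set t : ℕ → ℝ := fun k => ((k : ℝ) + 1) ^ (-(1 / β))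
  have htpos : ∀ k, 0 < t k := fun k => by positivity
  have hsum : Summable t := summable_nat_add_one_rpow_neg (by rwa [lt_div_iff₀ hβ0, one_mul])
  set O : ℕ → Set ℝ := fun K => ⋃ k ∈ Finset.range K, ball ((k : ℝ) + 1) (2 * t k)
  have hO : ∀ K, IsOpen (O K) := fun K => isOpen_biUnion fun _ _ => isOpen_ball
  have hb : ∀ K, Bornology.IsBounded (O K) := fun K =>
    (Bornology.isBounded_biUnion_finset _).2 fun _ _ => isBounded_ball
  refine ⟨O, hO, hb, ⟨∑' k, 2 * (2 * t k), fun K => ?_⟩, ?_⟩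
  · calc volume (O K) ≤ ∑ k ∈ Finset.range K, volume (ball ((k : ℝ) + 1) (2 * t k)) :=
          measure_biUnion_finset_le _ _
      _ = ENNReal.ofReal (∑ k ∈ Finset.range K, 2 * (2 * t k)) := by
          rw [ENNReal.ofReal_sum_of_nonneg fun k _ => by linarith [htpos k]]
          simp only [Real.volume_ball]
      _ ≤ _ := ENNReal.ofReal_le_ofReal <|
          ((hsum.mul_left 2).mul_left 2).sum_le_tsum _ fun k _ => by linarith [htpos k]
  · refine tendsto_of_tendsto_of_tendsto_of_le_of_le
      (ENNReal.tendsto_ofReal_atTop.comp Real.tendsto_sum_range_one_div_nat_succ_atTop)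
      tendsto_const_nhds (fun K => sum_le_paperMeasure fun k hk => ?_) fun K => le_top
    exact mem_tent_of_ball_subset (hO K) (hb K) (htpos k) (by linarith [htpos k])
      (Finset.subset_set_biUnion_of_mem (f := fun k : ℕ => ball ((k : ℝ) + 1) (2 * t k)) hk)

/-- for `0 < β < 1`, the measure `μ = Σ_{k≥1} (1/k) δ_{(k,k^{-1/β})}` on the
upper half-plane satisfies `μ(TI) ≤ C₀ |I|^β` for all bounded open intervals `I`, yet there
are bounded open sets `O_K` with `sup_K |O_K| < ∞` and `μ(T O_K) → ∞`; in particular no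
constant `C` satisfies `μ(TO) ≤ C |O|^β` for all bounded open `O ⊆ ℝ`. -/
theorem stmt1 (β : ℝ) (hβ0 : 0 < β) (hβ1 : β < 1) :
    (∃ C₀ : ℝ, 0 < C₀ ∧ ∀ a b : ℝ, a < b →
        paperMeasure β (tent (Set.Ioo a b)) ≤ ENNReal.ofReal (C₀ * (b - a) ^ β)) ∧
    (∃ O : ℕ → Set ℝ, (∀ K, IsOpen (O K)) ∧ (∀ K, Bornology.IsBounded (O K)) ∧
        (∃ M : ℝ, ∀ K, volume (O K) ≤ ENNReal.ofReal M) ∧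
        Tendsto (fun K => paperMeasure β (tent (O K))) atTop (nhds ⊤)) ∧
    ¬ ∃ C : ℝ, ∀ O : Set ℝ, IsOpen O → Bornology.IsBounded O →
        paperMeasure β (tent O) ≤ ENNReal.ofReal (C * (volume O).toReal ^ β) := by
  obtain ⟨O, hO, hb, ⟨M, hM⟩, hlim⟩ := exists_isOpen_tendsto_paperMeasure_tent hβ0 hβ1
  refine ⟨exists_paperMeasure_tent_Ioo_le hβ0 hβ1, ⟨O, hO, hb, ⟨M, hM⟩, hlim⟩, ?_⟩
  rintro ⟨C, hC⟩
  refine (ENNReal.ofReal_lt_top (r := |C| * max M 0 ^ β)).not_ge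
    (le_of_tendsto' hlim fun K => (hC (O K) (hO K) (hb K)).trans (ENNReal.ofReal_le_ofReal ?_))
  have hvol : (volume (O K)).toReal ≤ max M 0 :=
    ENNReal.toReal_le_of_le_ofReal (le_max_right _ _)
      ((hM K).trans (ENNReal.ofReal_le_ofReal (le_max_left _ _)))
  gcongr
  exact le_abs_self C

end
end

section
/- Let Φ : [0,∞) → [0,∞) satisfy Φ(0) = 0, Φ(cs) ≈ Φ(s) uniformly in s for each fixed c > 0, and the superadditivity condition Σ_j Φ(t_j^{1/n}) ≤ C Φ((Σ_j t_j)^{1/n}) for all finite or countable families of positive numbers t_j. Then for a positive Borel measure μ on R^{n+1}_+, the following are equivalent: (i) there is C₁ with μ(T B(z,r)) ≤ C₁ Φ(r) for all balls B(z,r) ⊆ R^n; (ii) there is C₂ with μ(TO) ≤ C₂ Φ(|O|^{1/n}) for all open sets O ⊆ R^n of finite Lebesgue measure. -/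
open MeasureTheory Metric Set ENNReal Filter

noncomputable section

/-- The tent over a ball with nonempty frontier contains the cone
`dist x z + t < r`, `0 < t`. -/
theorem mem_tent_ball_of_dist_add_lt {X : Type*} [MetricSpace X] {z : X} {r : ℝ}
    (hne : (frontier (ball z r)).Nonempty) {p : X × ℝ} (hp : 0 < p.2)
    (h : dist p.1 z + p.2 < r) : p ∈ tent (ball z r) := by
  refine ⟨mem_ball.2 (by linarith), hp, ?_⟩
  have hle : r - dist p.1 z ≤ infDist p.1 (frontier (ball z r)) := by
    refine (le_infDist hne).2 fun y hy => ?_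
    have hy' : dist y z = r := frontier_ball_subset_sphere hy
    have := dist_triangle_left y z p.1
    linarith
  linarith

/-- In positive dimension, a nonempty subset of `ℝ^n` of finite measure has nonempty frontier. -/
theorem frontier_nonempty_of_volume_lt_top {n : ℕ} (hn : 0 < n) {O : Set (En n)}
    (hO : O.Nonempty) (hfin : volume O < ⊤) : (frontier O).Nonempty := by
  have : Nonempty (Fin n) := ⟨⟨0, hn⟩⟩
  refine nonempty_frontier_iff.2 ⟨hO, ?_⟩
  rintro rfl
  rw [measure_univ_of_isAddLeftInvariant] at hfin
  exact lt_irrefl _ hfin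

/-- The ball about a point of an open set `O` reaching to the frontier of `O` lies in `O`. -/
theorem ball_infDist_frontier_subset {E : Type*} [NormedAddCommGroup E] [NormedSpace ℝ E]
    {O : Set E} (hO : IsOpen O) {x : E} (hx : x ∈ O) : ball x (infDist x (frontier O)) ⊆ O := by
  rcases le_or_gt (infDist x (frontier O)) 0 with h0 | h0
  · simp [ball_eq_empty.2 h0]
  · refine (convex_ball x _).isPreconnected.subset_left_of_subset_union hO
      isClosed_closure.isOpen_compl (disjoint_compl_right.mono_left subset_closure)
      (fun y hy => ?_) ⟨x, mem_ball_self h0, hx⟩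
    have hfr : y ∉ frontier O := ball_infDist_subset_compl hy
    rw [hO.frontier_eq] at hfr
    by_contra h
    simp only [mem_union, mem_compl_iff, not_or, not_not] at h
    exact hfr ⟨h.2, h.1⟩

/-- Superadditivity for arbitrary countable families with total at most `T`. The slack is filled
by a geometric series, which is why `2 * T` appears. -/
theorem tsum_le_of_superadditive {p C : ℝ} {Φ : ℝ → ℝ}
    (hsuper : ∀ t : ℕ → ℝ, (∀ j, 0 < t j) → Summable t →
      ∑' j, ENNReal.ofReal (Φ (t j ^ p)) ≤ ENNReal.ofReal (C * Φ ((∑' j, t j) ^ p)))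
    {ι : Type*} [Countable ι] {t : ι → ℝ} (ht : ∀ i, 0 < t i) {T : ℝ} (hT : 0 < T)
    (hsum : ∑' i, ENNReal.ofReal (t i) ≤ ENNReal.ofReal T) :
    ∑' i, ENNReal.ofReal (Φ (t i ^ p)) ≤ ENNReal.ofReal (C * Φ ((2 * T) ^ p)) := by
  have hs : Summable t := by
    have h := ENNReal.summable_toReal (ne_top_of_le_ne_top ofReal_ne_top hsum)
    simpa only [ENNReal.toReal_ofReal (ht _).le] using h
  have hle : ∑' i, t i ≤ T := by
    rw [← ENNReal.ofReal_tsum_of_nonneg (fun i => (ht i).le) hs] at hsum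
    exact (ENNReal.ofReal_le_ofReal_iff hT.le).1 hsum
  set a : ℝ := 2 * T - ∑' i, t i with ha
  have ha0 : 0 < a := by linarith
  let g : ι ⊕ ℕ → ℝ := Sum.elim t fun k => a / 2 / 2 ^ k
  have hg : ∀ i, 0 < g i := by
    rintro (i | k)
    · exact ht i
    · simp only [g, Sum.elim_inr]; positivity
  have hgsum : HasSum g (2 * T) := by
    have h := HasSum.sum (f := g) (a := ∑' i, t i) (b := a) hs.hasSum (hasSum_geometric_two' a)
    simpa [ha] using h
  obtain ⟨e⟩ : Nonempty (ℕ ≃ ι ⊕ ℕ) := inferInstance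
  have hge : HasSum (g ∘ e) (2 * T) := e.hasSum_iff.2 hgsum
  calc ∑' i, ENNReal.ofReal (Φ (t i ^ p))
      ≤ ∑' i, ENNReal.ofReal (Φ (g i ^ p)) :=
        ENNReal.tsum_comp_le_tsum_of_injective Sum.inl_injective
          fun i => ENNReal.ofReal (Φ (g i ^ p))
    _ = ∑' j, ENNReal.ofReal (Φ (g (e j) ^ p)) :=
        (e.tsum_eq fun i => ENNReal.ofReal (Φ (g i ^ p))).symm
    _ ≤ ENNReal.ofReal (C * Φ ((∑' j, (g ∘ e) j) ^ p)) :=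
        hsuper (g ∘ e) (fun j => hg _) hge.summable
    _ = ENNReal.ofReal (C * Φ ((2 * T) ^ p)) := by rw [hge.tsum_eq]

/-- Tents over open sets of finite measure are covered by tents over dilates of countably many
disjoint balls inside the set. -/
theorem exists_countable_disjoint_balls_tent_subset {n : ℕ} (hn : 0 < n) {O : Set (En n)}
    (hO : IsOpen O) (hne : O.Nonempty) (hfin : volume O < ⊤) :
    ∃ (u : Set (En n)) (r : En n → ℝ), u.Countable ∧ (∀ b ∈ u, 0 < r b) ∧
      (∀ b ∈ u, closedBall b (r b) ⊆ O) ∧ u.PairwiseDisjoint (fun b => closedBall b (r b)) ∧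
      tent O ⊆ ⋃ b ∈ u, tent (ball b (12 * r b)) := by
  have : Nonempty (Fin n) := ⟨⟨0, hn⟩⟩
  have hfr := frontier_nonempty_of_volume_lt_top hn hne hfin
  set r : En n → ℝ := fun x => infDist x (frontier O) / 2 with hr
  have hr0 : ∀ x ∈ O, 0 < r x := fun x hx => half_pos <|
    (isClosed_frontier.notMem_iff_infDist_pos hfr).1 fun h => by
      rw [hO.frontier_eq] at h; exact h.2 hx
  have hsub : ∀ x ∈ O, closedBall x (r x) ⊆ O := fun x hx =>
    (closedBall_subset_ball (half_lt_self (by simpa [hr] using hr0 x hx))).trans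
      (ball_infDist_frontier_subset hO hx)
  obtain ⟨R, hR⟩ : ∃ R, ∀ x ∈ O, r x ≤ R := by
    have hpos : 0 < volume (ball (0 : En n) 1) := measure_ball_pos _ _ one_pos
    have hlt : volume (ball (0 : En n) 1) < ⊤ := measure_ball_lt_top
    have hκ : 0 < (volume (ball (0 : En n) 1)).toReal := ENNReal.toReal_pos hpos.ne' hlt.ne
    refine ⟨max 1 ((volume O).toReal / (volume (ball (0 : En n) 1)).toReal), fun x hx => ?_⟩
    rcases le_total (r x) 1 with h1 | h1
    · exact le_max_of_le_left h1
    refine le_max_of_le_right ((le_div_iff₀ hκ).2 ?_)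
    have h := ENNReal.toReal_mono hfin.ne (measure_mono (μ := volume) (hsub x hx))
    rw [Measure.addHaar_closedBall _ _ (hr0 x hx).le, finrank_euclideanSpace_fin,
      ENNReal.toReal_mul, ENNReal.toReal_ofReal (pow_nonneg (hr0 x hx).le _)] at h
    exact (mul_le_mul_of_nonneg_right (le_self_pow₀ h1 hn.ne') hκ.le).trans h
  obtain ⟨u, huO, hdisj, hcov⟩ := Vitali.exists_disjoint_subfamily_covering_enlargement_closedBall
    O id r R hR 5 (by norm_num)
  simp only [id] at hdisj hcov
  refine ⟨u, r, ?_, fun b hb => hr0 b (huO hb), fun b hb => hsub b (huO hb), hdisj, ?_⟩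
  · exact hdisj.countable_of_nonempty_interior fun b hb =>
      (nonempty_ball.2 (hr0 b (huO hb))).mono ball_subset_interior_closedBall
  · rintro ⟨x, s⟩ ⟨hx, hs, hlt⟩
    simp only at hx hs hlt
    obtain ⟨b, hb, hxb⟩ := hcov x hx
    have hb0 := hr0 b (huO hb)
    have hdist : dist x b ≤ 5 * r b := hxb (mem_closedBall_self (hr0 x hx).le)
    have hd := infDist_le_infDist_add_dist (s := frontier O) (x := x) (y := b)
    have hrb : infDist b (frontier O) = 2 * r b := by simp only [hr]; ring
    refine mem_iUnion₂.2 ⟨b, hb, mem_tent_ball_of_dist_add_lt ?_ hs ?_⟩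
    · exact frontier_nonempty_of_volume_lt_top hn (nonempty_ball.2 (by linarith))
        measure_ball_lt_top
    · simp only
      linarith

/-- if `Φ(0) = 0`, `Φ(cs) ≈ Φ(s)`, and `Φ` is superadditive in the sense
`Σ_j Φ(t_j^{1/n}) ≤ C Φ((Σ_j t_j)^{1/n})`, then `μ(TB(z,r)) ≤ C₁ Φ(r)` for all balls is
equivalent to `μ(TO) ≤ C₂ Φ(|O|^{1/n})` for all open `O` of finite Lebesgue measure. -/
theorem stmt18 (n : ℕ) (hn : 0 < n) (Φ : ℝ → ℝ) (hΦ0 : Φ 0 = 0)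
    (hΦnn : ∀ s : ℝ, 0 ≤ s → 0 ≤ Φ s)
    (hΦdil : ∀ c > (0:ℝ), ∃ A > (0:ℝ), ∀ s ≥ (0:ℝ),
      Φ (c * s) ≤ A * Φ s ∧ Φ s ≤ A * Φ (c * s))
    (hΦsuper : ∃ C > (0:ℝ), ∀ t : ℕ → ℝ, (∀ j, 0 < t j) → Summable t →
      ∑' j, ENNReal.ofReal (Φ (t j ^ (1/(n : ℝ))))
        ≤ ENNReal.ofReal (C * Φ ((∑' j, t j) ^ (1/(n : ℝ)))))
    (μ : Measure (En n × ℝ)) :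
    (∃ C₁ > (0:ℝ), ∀ (z : En n) (r : ℝ), 0 < r →
        μ (tent (ball z r)) ≤ ENNReal.ofReal (C₁ * Φ r)) ↔
    (∃ C₂ > (0:ℝ), ∀ O : Set (En n), IsOpen O → volume O < ⊤ →
        μ (tent O) ≤ ENNReal.ofReal (C₂ * Φ ((volume O).toReal ^ (1/(n : ℝ))))) := by
  have : Nonempty (Fin n) := ⟨⟨0, hn⟩⟩
  set κ : ℝ := (volume (ball (0 : En n) 1)).toReal with hκdef
  have hκ : 0 < κ :=
    ENNReal.toReal_pos (measure_ball_pos _ _ one_pos).ne' measure_ball_lt_top.ne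
  have hroot : ∀ r : ℝ, 0 ≤ r → (r ^ n * κ) ^ (1 / (n : ℝ)) = κ ^ (1 / (n : ℝ)) * r := by
    intro r hr
    rw [Real.mul_rpow (pow_nonneg hr n) hκ.le, one_div, Real.pow_rpow_inv_natCast hr hn.ne',
      mul_comm]
  have hκ' : 0 < κ ^ (1 / (n : ℝ)) := Real.rpow_pos_of_pos hκ _
  constructor
  · rintro ⟨C₁, hC₁, hball⟩
    obtain ⟨C, hC, hsuper⟩ := hΦsuper
    obtain ⟨A, hA, hdilA⟩ := hΦdil 12 (by norm_num)
    obtain ⟨B, hB, hdilB⟩ := hΦdil (κ ^ (1 / (n : ℝ))) hκ'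
    obtain ⟨D, hD, hdilD⟩ := hΦdil (2 ^ (1 / (n : ℝ))) (by positivity)
    refine ⟨C₁ * A * B * (C * D), by positivity, fun O hO hfin => ?_⟩
    rcases O.eq_empty_or_nonempty with rfl | hne
    · have : tent (∅ : Set (En n)) = ∅ := by simp [tent]
      simp [this]
    obtain ⟨u, r, hu, hr0, hsub, hdisj, hcov⟩ :=
      exists_countable_disjoint_balls_tent_subset hn hO hne hfin
    have : Countable u := hu.to_subtype
    have hV : 0 < (volume O).toReal :=
      ENNReal.toReal_pos (hO.measure_pos volume hne).ne' hfin.ne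
    have hvol : ∀ b : u, volume (closedBall (b : En n) (r b)) = ENNReal.ofReal (r b ^ n * κ) := by
      intro b
      rw [Measure.addHaar_closedBall _ _ (hr0 b b.2).le, finrank_euclideanSpace_fin,
        ENNReal.ofReal_mul (pow_nonneg (hr0 b b.2).le _), hκdef,
        ENNReal.ofReal_toReal measure_ball_lt_top.ne]
    have hsum : ∑' b : u, ENNReal.ofReal (r b ^ n * κ) ≤ ENNReal.ofReal (volume O).toReal := by
      rw [ENNReal.ofReal_toReal hfin.ne]
      simp_rw [← hvol]
      rw [← measure_biUnion hu hdisj fun b _ => isClosed_closedBall.measurableSet]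
      exact measure_mono (iUnion₂_subset hsub)
    have hpack := tsum_le_of_superadditive hsuper
      (fun b : u => mul_pos (pow_pos (hr0 b b.2) n) hκ) hV hsum
    calc μ (tent O) ≤ μ (⋃ b ∈ u, tent (ball b (12 * r b))) := measure_mono hcov
      _ ≤ ∑' b : u, μ (tent (ball (b : En n) (12 * r b))) := measure_biUnion_le μ hu _
      _ ≤ ∑' b : u, ENNReal.ofReal (C₁ * A * B) *
            ENNReal.ofReal (Φ ((r b ^ n * κ) ^ (1 / (n : ℝ)))) := by
          refine ENNReal.tsum_le_tsum fun b => ?_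
          have hb := hr0 b b.2
          refine (hball b (12 * r b) (by linarith)).trans ?_
          rw [← ENNReal.ofReal_mul (by positivity), hroot _ hb.le]
          refine ENNReal.ofReal_le_ofReal ?_
          calc C₁ * Φ (12 * r b) ≤ C₁ * (A * (B * Φ (κ ^ (1 / (n : ℝ)) * r b))) := by
                gcongr
                refine (hdilA _ hb.le).1.trans ?_
                gcongr
                exact (hdilB _ hb.le).2
            _ = _ := by ring
      _ ≤ ENNReal.ofReal (C₁ * A * B) *
            ENNReal.ofReal (C * Φ ((2 * (volume O).toReal) ^ (1 / (n : ℝ)))) := by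
          rw [ENNReal.tsum_mul_left]
          gcongr
      _ ≤ _ := by
          rw [← ENNReal.ofReal_mul (by positivity)]
          refine ENNReal.ofReal_le_ofReal ?_
          rw [mul_assoc (C₁ * A * B), mul_assoc C, Real.mul_rpow zero_le_two hV.le]
          gcongr
          exact (hdilD _ (by positivity)).1
  · rintro ⟨C₂, hC₂, hopen⟩
    obtain ⟨B, hB, hdilB⟩ := hΦdil (κ ^ (1 / (n : ℝ))) hκ'
    refine ⟨C₂ * B, by positivity, fun z r hr => ?_⟩
    refine (hopen _ isOpen_ball measure_ball_lt_top).trans (ENNReal.ofReal_le_ofReal ?_)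
    rw [Measure.addHaar_ball _ _ hr.le, finrank_euclideanSpace_fin, ENNReal.toReal_mul,
      ENNReal.toReal_ofReal (pow_nonneg hr.le _), hroot r hr.le, mul_assoc]
    gcongr
    exact (hdilB r hr.le).1

end
end
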